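/- arXiv:2101.05941 — 6 statements merged into one kernel-verified Lean document; each statement's English description precedes it below -/
import Mathlib

section
/- For any sequence (x_k) in ℝ^d satisfying x_{k+1} = A x_k + w_k for given vectors w_k ∈ ℝ^d, and the dual process (z_i), the telescoping identity x_t = Σ_{i=0}^{t−1} z_iᵀ w_{t−1−i} − Σ_{i=0}^{t} α_iᵀ C x_{t−i} + z_tᵀ x_0 holds for every t ≥ 1. -/
open Matrix

/-- Partial telescoping: the dual process run for `s ≤ t` steps backwards from time `t`. -/
theorem telescoping_identity_partial {d q : ℕ}
    {A : Matrix (Fin d) (Fin d) ℝ} {C : Matrix (Fin q) (Fin d) ℝ}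
    {α : ℕ → Matrix (Fin q) (Fin d) ℝ} {z : ℕ → Matrix (Fin d) (Fin d) ℝ}
    (hz0 : z 0 = 1 + Cᵀ * α 0)
    (hz : ∀ i : ℕ, z (i + 1) = Aᵀ * z i + Cᵀ * α (i + 1))
    {x w : ℕ → Fin d → ℝ}
    (hx : ∀ k : ℕ, x (k + 1) = A.mulVec (x k) + w k) (t s : ℕ) (hs : s ≤ t) :
    x t = (∑ i ∈ Finset.range s, (z i)ᵀ.mulVec (w (t - 1 - i)))
          - (∑ i ∈ Finset.range (s + 1), (α i)ᵀ.mulVec (C.mulVec (x (t - i))))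
          + (z s)ᵀ.mulVec (x (t - s)) := by
  induction s with
  | zero => simp [hz0, Matrix.add_mulVec]
  | succ s ih =>
    obtain ⟨m, rfl⟩ := Nat.exists_eq_add_of_le hs
    have h₁ : s + 1 + m - s = m + 1 := by omega
    have h₂ : s + 1 + m - 1 - s = m := by omega
    have h₃ : s + 1 + m - (s + 1) = m := by omega
    have hdual : (z (s + 1))ᵀ.mulVec (x m)
        = (z s)ᵀ.mulVec (A.mulVec (x m)) + (α (s + 1))ᵀ.mulVec (C.mulVec (x m)) := by
      simp [hz, Matrix.add_mulVec]
    rw [Finset.sum_range_succ, Finset.sum_range_succ _ (s + 1), h₂, h₃, hdual]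
    refine (ih (by omega)).trans ?_
    rw [h₁, hx, Matrix.mulVec_add]
    abel

/-- For any sequence `x` with `x (k+1) = A x k + w k` and the dual process `z`,
the telescoping identity
`x t = ∑_{i=0}^{t-1} (z i)ᵀ w (t-1-i) − ∑_{i=0}^{t} (α i)ᵀ C x (t-i) + (z t)ᵀ x 0`
holds for every `t ≥ 1`. -/
theorem telescoping_identity (d q : ℕ)
    (A : Matrix (Fin d) (Fin d) ℝ) (C : Matrix (Fin q) (Fin d) ℝ)
    (α : ℕ → Matrix (Fin q) (Fin d) ℝ) (z : ℕ → Matrix (Fin d) (Fin d) ℝ)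
    (hz0 : z 0 = 1 + Cᵀ * α 0)
    (hz : ∀ i : ℕ, z (i + 1) = Aᵀ * z i + Cᵀ * α (i + 1))
    (x w : ℕ → Fin d → ℝ)
    (hx : ∀ k : ℕ, x (k + 1) = A.mulVec (x k) + w k) :
    ∀ t : ℕ, 1 ≤ t →
      x t = (∑ i ∈ Finset.range t, (z i)ᵀ.mulVec (w (t - 1 - i)))
            - (∑ i ∈ Finset.range (t + 1), (α i)ᵀ.mulVec (C.mulVec (x (t - i))))
            + (z t)ᵀ.mulVec (x 0) := by
  intro t _
  simpa only [Nat.sub_self] using telescoping_identity_partial hz0 hz hx t t le_rfl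
end

section
/- For any sequences (x_k) in ℝ^d and (y_k) in ℝ^q satisfying x_{k+1} = A x_k + w_k and y_k = C x_k + ς_k for given vectors w_k ∈ ℝ^d and ς_k ∈ ℝ^q, the estimation error satisfies, for every t ≥ 1, x_t − x̂_t = z_tᵀ (x_0 − x̂_0⁻) + Σ_{i=0}^{t−1} z_iᵀ w_{t−1−i} + Σ_{i=0}^{t} α_iᵀ ς_{t−i}. -/
open Matrix

/-- Partial summation of the state along the dual process: running the dual recursion for `n`
steps moves the state `x t` back to `x (t - n)`, at the cost of the process noise met on the way. -/
theorem state_add_sum_dual_control {m n R : Type*} [Fintype m] [DecidableEq m] [Fintype n]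
    [CommRing R] (A : Matrix m m R) (C : Matrix n m R)
    (α : ℕ → Matrix n m R) (z : ℕ → Matrix m m R)
    (hz0 : z 0 = 1 + Cᵀ * α 0)
    (hz : ∀ i : ℕ, z (i + 1) = Aᵀ * z i + Cᵀ * α (i + 1))
    (x w : ℕ → m → R) (hx : ∀ k : ℕ, x (k + 1) = A.mulVec (x k) + w k)
    (t k : ℕ) (hk : k ≤ t) :
    x t + ∑ i ∈ Finset.range (k + 1), (α i)ᵀ.mulVec (C.mulVec (x (t - i)))
      = (z k)ᵀ.mulVec (x (t - k))
        + ∑ i ∈ Finset.range k, (z i)ᵀ.mulVec (w (t - 1 - i)) := by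
  induction k with
  | zero => simp [hz0, Matrix.add_mulVec]
  | succ k ih =>
    have hstep : x (t - k) = A.mulVec (x (t - (k + 1))) + w (t - 1 - k) := by
      rw [show t - k = t - (k + 1) + 1 by lia, hx, show t - 1 - k = t - (k + 1) by lia]
    rw [Finset.sum_range_succ, ← add_assoc, ih (by lia), hstep, Finset.sum_range_succ, hz]
    simp only [Matrix.transpose_add, Matrix.transpose_mul, Matrix.transpose_transpose,
      Matrix.add_mulVec, Matrix.mulVec_add, Matrix.mulVec_mulVec]
    abel

/-- With `x (k+1) = A x k + w k`, `y k = C x k + ς k`, the dual process `z`,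
and the estimate `xhat t = (z t)ᵀ xhat0m − ∑_{i=0}^{t} (α i)ᵀ y (t-i)` (where `xhat0m` is the
prior mean `x̂₀⁻`), for every `t ≥ 1`:
`x t − xhat t = (z t)ᵀ (x 0 − xhat0m) + ∑_{i=0}^{t-1} (z i)ᵀ w (t-1-i) + ∑_{i=0}^{t} (α i)ᵀ ς (t-i)`. -/
theorem estimation_error_formula (d q : ℕ)
    (A : Matrix (Fin d) (Fin d) ℝ) (C : Matrix (Fin q) (Fin d) ℝ)
    (α : ℕ → Matrix (Fin q) (Fin d) ℝ) (z : ℕ → Matrix (Fin d) (Fin d) ℝ)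
    (hz0 : z 0 = 1 + Cᵀ * α 0)
    (hz : ∀ i : ℕ, z (i + 1) = Aᵀ * z i + Cᵀ * α (i + 1))
    (x w : ℕ → Fin d → ℝ) (y ς : ℕ → Fin q → ℝ)
    (hx : ∀ k : ℕ, x (k + 1) = A.mulVec (x k) + w k)
    (hy : ∀ k : ℕ, y k = C.mulVec (x k) + ς k)
    (xhat0m : Fin d → ℝ) (xhat : ℕ → Fin d → ℝ)
    (hxhat : ∀ t : ℕ, xhat t = (z t)ᵀ.mulVec xhat0m
        - ∑ i ∈ Finset.range (t + 1), (α i)ᵀ.mulVec (y (t - i))) :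
    ∀ t : ℕ, 1 ≤ t →
      x t - xhat t = (z t)ᵀ.mulVec (x 0 - xhat0m)
            + (∑ i ∈ Finset.range t, (z i)ᵀ.mulVec (w (t - 1 - i)))
            + (∑ i ∈ Finset.range (t + 1), (α i)ᵀ.mulVec (ς (t - i))) := by
  intro t _
  have h := state_add_sum_dual_control A C α z hz0 hz x w hx t t le_rfl
  rw [Nat.sub_self] at h
  simp only [hxhat, hy, Matrix.mulVec_add, Matrix.mulVec_sub, Finset.sum_add_distrib]
  rw [sub_add_eq_add_sub, ← h]
  abel
end

section
/- Let Σ be a symmetric positive-semidefinite d×d real matrix and R a symmetric positive-definite q×q real matrix, and let C be a real q×d matrix (so C Σ Cᵀ + R is invertible). Then for every α ∈ ℝ^{q×d}, trace((I_d + Cᵀα)ᵀ Σ (I_d + Cᵀα) + αᵀ R α) ≥ trace(Σ − Σ Cᵀ (C Σ Cᵀ + R)⁻¹ C Σ), with equality when α = −(C Σ Cᵀ + R)⁻¹ C Σ. -/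
open Matrix

/-- Completing the square: the quadratic cost exceeds its minimal value by a quadratic form
in the deviation of `α` from `-(C * S * Cᵀ + R)⁻¹ * C * S`. -/
theorem quadratic_cost_eq_add_deviation {m n 𝕜 : Type*} [Fintype m] [DecidableEq m]
    [Fintype n] [DecidableEq n] [CommRing 𝕜]
    {S : Matrix n n 𝕜} {R : Matrix m m 𝕜} (C : Matrix m n 𝕜) (hS : Sᵀ = S) (hR : Rᵀ = R)
    (hM : IsUnit (C * S * Cᵀ + R).det) (α : Matrix m n 𝕜) :
    (1 + Cᵀ * α)ᵀ * S * (1 + Cᵀ * α) + αᵀ * R * α =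
      S - S * Cᵀ * (C * S * Cᵀ + R)⁻¹ * C * S +
        (α + (C * S * Cᵀ + R)⁻¹ * C * S)ᵀ * (C * S * Cᵀ + R) *
          (α + (C * S * Cᵀ + R)⁻¹ * C * S) := by
  have hMt : (C * S * Cᵀ + R)ᵀ = C * S * Cᵀ + R := by
    simp [transpose_mul, hS, hR, Matrix.mul_assoc]
  have hcost : (1 + Cᵀ * α)ᵀ * S * (1 + Cᵀ * α) + αᵀ * R * α =
      S + S * Cᵀ * α + αᵀ * (C * S) + αᵀ * (C * S * Cᵀ + R) * α := by
    simp only [transpose_add, transpose_one, transpose_mul, transpose_transpose,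
      Matrix.add_mul, Matrix.mul_add, Matrix.one_mul, Matrix.mul_one, Matrix.mul_assoc]
    abel
  rw [hcost]
  generalize C * S * Cᵀ + R = M at hM hMt ⊢
  have hKt : (M⁻¹ * C * S)ᵀ = S * Cᵀ * M⁻¹ := by
    simp [transpose_mul, transpose_nonsing_inv, hS, hMt, Matrix.mul_assoc]
  have hMK : M * (M⁻¹ * C * S) = C * S := by
    rw [Matrix.mul_assoc, mul_nonsing_inv_cancel_left _ _ hM]
  have hKM : S * Cᵀ * M⁻¹ * M = S * Cᵀ := nonsing_inv_mul_cancel_right _ _ hM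
  rw [transpose_add, hKt, Matrix.add_mul, hKM, Matrix.mul_add, Matrix.add_mul, Matrix.add_mul,
    Matrix.mul_assoc αᵀ M (M⁻¹ * C * S), hMK]
  simp only [Matrix.mul_assoc]
  abel

/-- For `S` symmetric positive semidefinite (d×d), `R` symmetric positive definite
(q×q) and any `C : q×d`, for every `α`,
`trace((I + Cᵀα)ᵀ S (I + Cᵀα) + αᵀ R α) ≥ trace(S − S Cᵀ (C S Cᵀ + R)⁻¹ C S)`,
with equality when `α = −(C S Cᵀ + R)⁻¹ C S`. -/
theorem one_step_variance_min (d q : ℕ)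
    (S : Matrix (Fin d) (Fin d) ℝ) (R : Matrix (Fin q) (Fin q) ℝ)
    (C : Matrix (Fin q) (Fin d) ℝ)
    (hS : S.PosSemidef) (hR : R.PosDef) :
    (∀ α : Matrix (Fin q) (Fin d) ℝ,
      ((1 + Cᵀ * α)ᵀ * S * (1 + Cᵀ * α) + αᵀ * R * α).trace ≥
        (S - S * Cᵀ * (C * S * Cᵀ + R)⁻¹ * C * S).trace) ∧
    (((1 + Cᵀ * (-((C * S * Cᵀ + R)⁻¹ * C * S)))ᵀ * S * (1 + Cᵀ * (-((C * S * Cᵀ + R)⁻¹ * C * S)))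
        + (-((C * S * Cᵀ + R)⁻¹ * C * S))ᵀ * R * (-((C * S * Cᵀ + R)⁻¹ * C * S))).trace =
      (S - S * Cᵀ * (C * S * Cᵀ + R)⁻¹ * C * S).trace) := by
  have hM : (C * S * Cᵀ + R).PosDef := by
    simpa using hR.posSemidef_add (hS.mul_mul_conjTranspose_same C)
  have hSt : Sᵀ = S := by simpa using hS.isHermitian.eq
  have hRt : Rᵀ = R := by simpa using hR.isHermitian.eq
  have hdet : IsUnit (C * S * Cᵀ + R).det := hM.det_pos.ne'.isUnit
  refine ⟨fun α => ?_, ?_⟩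
  · rw [quadratic_cost_eq_add_deviation C hSt hRt hdet, trace_add, ge_iff_le,
      le_add_iff_nonneg_right]
    simpa using (hM.posSemidef.conjTranspose_mul_mul_same
      (α + (C * S * Cᵀ + R)⁻¹ * C * S)).trace_nonneg
  · rw [quadratic_cost_eq_add_deviation C hSt hRt hdet]
    simp
end

section
/- (One-step dynamic programming identity.) Let A be a real d×d matrix, C a real q×d matrix, Σ and Q symmetric positive-semidefinite d×d real matrices, and R a symmetric positive-definite q×q real matrix. Then for every z ∈ ℝ^{d×d} and every α ∈ ℝ^{q×d}, trace((Aᵀz + Cᵀα)ᵀ Σ (Aᵀz + Cᵀα) + αᵀ R α + zᵀ Q z) ≥ trace(zᵀ (A(Σ − Σ Cᵀ (C Σ Cᵀ + R)⁻¹ C Σ)Aᵀ + Q) z), with equality when α = −(C Σ Cᵀ + R)⁻¹ C Σ Aᵀ z. -/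
open Matrix

/-- Completing the square for a quadratic form with invertible symmetric matrix `M`. -/
theorem transpose_mul_mul_complete_square {m n K : Type*} [Fintype m] [DecidableEq m]
    [CommRing K] {M : Matrix m m K} (hM : IsUnit M.det) (hsymm : Mᵀ = M) (a b : Matrix m n K) :
    (a + M⁻¹ * b)ᵀ * M * (a + M⁻¹ * b) =
      aᵀ * M * a + aᵀ * b + bᵀ * a + bᵀ * M⁻¹ * b := by
  have hinv : (M⁻¹)ᵀ = M⁻¹ := by rw [transpose_nonsing_inv, hsymm]
  have h₁ : M * (M⁻¹ * b) = b := mul_nonsing_inv_cancel_left M b hM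
  have h₂ : M⁻¹ * (M * a) = a := nonsing_inv_mul_cancel_left M a hM
  simp only [transpose_add, transpose_mul, hinv, Matrix.mul_assoc, Matrix.mul_add,
    Matrix.add_mul, h₁, h₂]
  abel

/-- The one-step cost exceeds the Riccati value by a quadratic form in the deviation of the control
from the optimal feedback. -/
theorem one_step_cost_eq_riccati_add_square {m n p K : Type*} [Fintype m] [Fintype n]
    [DecidableEq m] [CommRing K] (A : Matrix n n K) (C : Matrix m n K)
    {S : Matrix n n K} (Q : Matrix n n K) {R : Matrix m m K} (hS : Sᵀ = S) (hR : Rᵀ = R)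
    (hM : IsUnit (C * S * Cᵀ + R).det) (z : Matrix n p K) (α : Matrix m p K) :
    (Aᵀ * z + Cᵀ * α)ᵀ * S * (Aᵀ * z + Cᵀ * α) + αᵀ * R * α + zᵀ * Q * z =
      zᵀ * (A * (S - S * Cᵀ * (C * S * Cᵀ + R)⁻¹ * C * S) * Aᵀ + Q) * z +
        (α + (C * S * Cᵀ + R)⁻¹ * C * S * Aᵀ * z)ᵀ * (C * S * Cᵀ + R) *
          (α + (C * S * Cᵀ + R)⁻¹ * C * S * Aᵀ * z) := by
  have hsymm : (C * S * Cᵀ + R)ᵀ = C * S * Cᵀ + R := by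
    simp [transpose_mul, hS, hR, Matrix.mul_assoc]
  have hsq := transpose_mul_mul_complete_square hM hsymm α (C * S * Aᵀ * z)
  have hassoc : (C * S * Cᵀ + R)⁻¹ * C * S * Aᵀ * z =
      (C * S * Cᵀ + R)⁻¹ * (C * S * Aᵀ * z) := by
    simp only [Matrix.mul_assoc]
  rw [hassoc, hsq]
  generalize (C * S * Cᵀ + R)⁻¹ = N
  simp only [transpose_add, transpose_mul, transpose_transpose, hS, Matrix.mul_assoc,
    Matrix.mul_add, Matrix.add_mul, Matrix.mul_sub, Matrix.sub_mul]
  abel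

/-- One-step dynamic programming identity: For `S, Q` symmetric positive
semidefinite (d×d), `R` symmetric positive definite (q×q), any `A : d×d`, `C : q×d`, every
`z : d×d` and every `α : q×d`,
`trace((Aᵀz + Cᵀα)ᵀ S (Aᵀz + Cᵀα) + αᵀ R α + zᵀ Q z) ≥
 trace(zᵀ (A(S − S Cᵀ (C S Cᵀ + R)⁻¹ C S)Aᵀ + Q) z)`,
with equality when `α = −(C S Cᵀ + R)⁻¹ C S Aᵀ z`. -/
theorem one_step_dynamic_programming (d q : ℕ)
    (A : Matrix (Fin d) (Fin d) ℝ) (C : Matrix (Fin q) (Fin d) ℝ)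
    (S Q : Matrix (Fin d) (Fin d) ℝ) (R : Matrix (Fin q) (Fin q) ℝ)
    (hS : S.PosSemidef) (hQ : Q.PosSemidef) (hR : R.PosDef) :
    (∀ z : Matrix (Fin d) (Fin d) ℝ, ∀ α : Matrix (Fin q) (Fin d) ℝ,
      ((Aᵀ * z + Cᵀ * α)ᵀ * S * (Aᵀ * z + Cᵀ * α) + αᵀ * R * α + zᵀ * Q * z).trace ≥
        (zᵀ * (A * (S - S * Cᵀ * (C * S * Cᵀ + R)⁻¹ * C * S) * Aᵀ + Q) * z).trace) ∧
    (∀ z : Matrix (Fin d) (Fin d) ℝ,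
      ((Aᵀ * z + Cᵀ * (-((C * S * Cᵀ + R)⁻¹ * C * S * Aᵀ * z)))ᵀ * S
          * (Aᵀ * z + Cᵀ * (-((C * S * Cᵀ + R)⁻¹ * C * S * Aᵀ * z)))
        + (-((C * S * Cᵀ + R)⁻¹ * C * S * Aᵀ * z))ᵀ * R * (-((C * S * Cᵀ + R)⁻¹ * C * S * Aᵀ * z))
        + zᵀ * Q * z).trace =
      (zᵀ * (A * (S - S * Cᵀ * (C * S * Cᵀ + R)⁻¹ * C * S) * Aᵀ + Q) * z).trace) := by
  have hM : (C * S * Cᵀ + R).PosDef := by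
    have h := hS.mul_mul_conjTranspose_same C
    rw [conjTranspose_eq_transpose_of_trivial] at h
    exact PosDef.posSemidef_add h hR
  have key := fun z α ↦ one_step_cost_eq_riccati_add_square (p := Fin d) A C Q
    ((conjTranspose_eq_transpose_of_trivial S).symm.trans hS.isHermitian)
    ((conjTranspose_eq_transpose_of_trivial R).symm.trans hR.isHermitian)
    ((isUnit_iff_isUnit_det _).mp hM.isUnit) z α
  refine ⟨fun z α ↦ ?_, fun z ↦ ?_⟩
  · have h := (hM.posSemidef.conjTranspose_mul_mul_same
      (α + (C * S * Cᵀ + R)⁻¹ * C * S * Aᵀ * z)).trace_nonneg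
    rw [conjTranspose_eq_transpose_of_trivial] at h
    rw [key, trace_add]
    exact le_add_of_nonneg_right h
  · rw [key, neg_add_cancel, Matrix.mul_zero, add_zero]
end

section
/- (Lemma 2, equivalence of FIE and MHE costs.) Suppose R is positive definite and Σ_0⁻, Q are positive semidefinite. Define recursively Σ_0 = Σ_0⁻ − Σ_0⁻ Cᵀ (C Σ_0⁻ Cᵀ + R)⁻¹ C Σ_0⁻, and for k ≥ 1, Σ_k⁻ = A Σ_{k−1} Aᵀ + Q and Σ_k = Σ_k⁻ − Σ_k⁻ Cᵀ (C Σ_k⁻ Cᵀ + R)⁻¹ C Σ_k⁻ (each Σ_k is positive semidefinite so each inverse exists). Then for every t ≥ N ≥ 0, the infimum over all control sequences α_0, …, α_t ∈ ℝ^{q×d} of trace(z_tᵀ Σ_0⁻ z_t + α_tᵀ R α_t + Σ_{i=0}^{t−1} (z_iᵀ Q z_i + α_iᵀ R α_i)), where (z_i) is the dual process generated by α_0, …, α_t, equals the infimum over all control sequences α_0, …, α_N ∈ ℝ^{q×d} of trace(z_Nᵀ Σ_{t−N}⁻ z_N + α_Nᵀ R α_N + Σ_{i=0}^{N−1} (z_iᵀ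 Q z_i + α_iᵀ R α_i)). -/
open Matrix

/-- The dual process `z 0 = I + Cᵀ α 0`, `z (i+1) = Aᵀ z i + Cᵀ α (i+1)`. -/
noncomputable def dualZ {d q : ℕ} (A : Matrix (Fin d) (Fin d) ℝ) (C : Matrix (Fin q) (Fin d) ℝ)
    (α : ℕ → Matrix (Fin q) (Fin d) ℝ) : ℕ → Matrix (Fin d) (Fin d) ℝ
  | 0 => 1 + Cᵀ * α 0
  | (i + 1) => Aᵀ * dualZ A C α i + Cᵀ * α (i + 1)

/-- The cost `trace(z_sᵀ Σ⁻ z_s + α_sᵀ R α_s + ∑_{i=0}^{s−1} (z_iᵀ Q z_i + α_iᵀ R α_i))`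
of a control sequence `α` over horizon `s`, with terminal-cost matrix `Sm`. -/
noncomputable def mvCost {d q : ℕ} (A : Matrix (Fin d) (Fin d) ℝ) (C : Matrix (Fin q) (Fin d) ℝ)
    (Sm Q : Matrix (Fin d) (Fin d) ℝ) (R : Matrix (Fin q) (Fin q) ℝ)
    (s : ℕ) (α : ℕ → Matrix (Fin q) (Fin d) ℝ) : ℝ :=
  ((dualZ A C α s)ᵀ * Sm * dualZ A C α s + (α s)ᵀ * R * α s
    + ∑ i ∈ Finset.range s, ((dualZ A C α i)ᵀ * Q * dualZ A C α i + (α i)ᵀ * R * α i)).trace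

/-- The prior covariances `Σ_k⁻`: `Σ_0⁻` given, and
`Σ_{k+1}⁻ = A Σ_k Aᵀ + Q` where `Σ_k = Σ_k⁻ − Σ_k⁻ Cᵀ (C Σ_k⁻ Cᵀ + R)⁻¹ C Σ_k⁻`. -/
noncomputable def sigMinus {d q : ℕ} (A : Matrix (Fin d) (Fin d) ℝ) (C : Matrix (Fin q) (Fin d) ℝ)
    (S0m Q : Matrix (Fin d) (Fin d) ℝ) (R : Matrix (Fin q) (Fin q) ℝ) :
    ℕ → Matrix (Fin d) (Fin d) ℝ
  | 0 => S0m
  | (k + 1) =>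
    let Sm := sigMinus A C S0m Q R k
    A * (Sm - Sm * Cᵀ * (C * Sm * Cᵀ + R)⁻¹ * C * Sm) * Aᵀ + Q

/-- The posterior covariance `S - S Cᵀ (C S Cᵀ + R)⁻¹ C S` of a prior covariance `S`. -/
noncomputable def posterior {d q : ℕ} (C : Matrix (Fin q) (Fin d) ℝ)
    (S : Matrix (Fin d) (Fin d) ℝ) (R : Matrix (Fin q) (Fin q) ℝ) : Matrix (Fin d) (Fin d) ℝ :=
  S - S * Cᵀ * (C * S * Cᵀ + R)⁻¹ * C * S

lemma posDef_innovation {d q : ℕ} (C : Matrix (Fin q) (Fin d) ℝ)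
    {S : Matrix (Fin d) (Fin d) ℝ} {R : Matrix (Fin q) (Fin q) ℝ}
    (hR : R.PosDef) (hS : S.PosSemidef) : (C * S * Cᵀ + R).PosDef := by
  have h := hS.mul_mul_conjTranspose_same C
  rw [conjTranspose_eq_transpose_of_trivial] at h
  exact PosDef.posSemidef_add h hR

lemma complete_square {d q : ℕ} (C : Matrix (Fin q) (Fin d) ℝ)
    {S : Matrix (Fin d) (Fin d) ℝ} {R : Matrix (Fin q) (Fin q) ℝ}
    (hR : R.PosDef) (hS : S.PosSemidef)
    (y : Matrix (Fin d) (Fin d) ℝ) (a : Matrix (Fin q) (Fin d) ℝ) :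
    (y + Cᵀ * a)ᵀ * S * (y + Cᵀ * a) + aᵀ * R * a =
      yᵀ * posterior C S R * y +
      (a + (C * S * Cᵀ + R)⁻¹ * C * S * y)ᵀ * (C * S * Cᵀ + R) *
        (a + (C * S * Cᵀ + R)⁻¹ * C * S * y) := by
  have hM := posDef_innovation C hR hS
  unfold posterior
  have hSt : Sᵀ = S := by simpa using hS.isHermitian.eq
  have hMt : (C * S * Cᵀ + R)ᵀ = C * S * Cᵀ + R := by simpa using hM.isHermitian.eq
  have hdet : IsUnit (C * S * Cᵀ + R).det := hM.det_pos.ne'.isUnit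
  have hquad : aᵀ * R * a = aᵀ * (C * S * Cᵀ + R) * a - aᵀ * (C * S * Cᵀ) * a := by
    rw [Matrix.mul_add, Matrix.add_mul, add_sub_cancel_left]
  rw [hquad]
  generalize C * S * Cᵀ + R = M at hMt hdet ⊢
  have h₁ : ∀ X : Matrix (Fin q) (Fin d) ℝ, M * (M⁻¹ * X) = X :=
    fun X => mul_nonsing_inv_cancel_left M X hdet
  have h₂ : ∀ X : Matrix (Fin q) (Fin d) ℝ, M⁻¹ * (M * X) = X :=
    fun X => nonsing_inv_mul_cancel_left M X hdet
  simp only [transpose_add, transpose_mul, transpose_transpose, transpose_nonsing_inv, hSt, hMt,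
    Matrix.add_mul, Matrix.mul_add, Matrix.sub_mul, Matrix.mul_sub, Matrix.mul_assoc, h₁, h₂]
  abel

lemma posSemidef_posterior {d q : ℕ} (C : Matrix (Fin q) (Fin d) ℝ)
    {S : Matrix (Fin d) (Fin d) ℝ} {R : Matrix (Fin q) (Fin q) ℝ}
    (hR : R.PosDef) (hS : S.PosSemidef) : (posterior C S R).PosSemidef := by
  have h := complete_square C hR hS 1 (-((C * S * Cᵀ + R)⁻¹ * C * S))
  simp only [Matrix.mul_one, Matrix.one_mul, transpose_one, neg_add_cancel, transpose_zero,
    Matrix.zero_mul, add_zero] at h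
  rw [← h]
  refine PosSemidef.add ?_ ?_
  · simpa only [conjTranspose_eq_transpose_of_trivial] using hS.conjTranspose_mul_mul_same _
  · simpa only [conjTranspose_eq_transpose_of_trivial] using
      hR.posSemidef.conjTranspose_mul_mul_same _

lemma posSemidef_prior_succ {d q : ℕ} (A : Matrix (Fin d) (Fin d) ℝ)
    (C : Matrix (Fin q) (Fin d) ℝ) {S Q : Matrix (Fin d) (Fin d) ℝ} {R : Matrix (Fin q) (Fin q) ℝ}
    (hR : R.PosDef) (hS : S.PosSemidef) (hQ : Q.PosSemidef) :
    (A * posterior C S R * Aᵀ + Q).PosSemidef := by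
  have h := (posSemidef_posterior C hR hS).mul_mul_conjTranspose_same A
  rw [conjTranspose_eq_transpose_of_trivial] at h
  exact h.add hQ

lemma posSemidef_sigMinus {d q : ℕ} (A : Matrix (Fin d) (Fin d) ℝ)
    (C : Matrix (Fin q) (Fin d) ℝ) {S Q : Matrix (Fin d) (Fin d) ℝ} {R : Matrix (Fin q) (Fin q) ℝ}
    (hR : R.PosDef) (hS : S.PosSemidef) (hQ : Q.PosSemidef) (k : ℕ) :
    (sigMinus A C S Q R k).PosSemidef := by
  induction k with
  | zero => exact hS
  | succ k ih => exact posSemidef_prior_succ A C hR ih hQ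

lemma trace_quad_nonneg {m n : ℕ} {P : Matrix (Fin m) (Fin m) ℝ} (hP : P.PosSemidef)
    (X : Matrix (Fin m) (Fin n) ℝ) : 0 ≤ (Xᵀ * P * X).trace := by
  have h := (hP.conjTranspose_mul_mul_same X).trace_nonneg
  rwa [conjTranspose_eq_transpose_of_trivial] at h

lemma mvCost_nonneg {d q : ℕ} (A : Matrix (Fin d) (Fin d) ℝ) (C : Matrix (Fin q) (Fin d) ℝ)
    {S Q : Matrix (Fin d) (Fin d) ℝ} {R : Matrix (Fin q) (Fin q) ℝ}
    (hR : R.PosDef) (hS : S.PosSemidef) (hQ : Q.PosSemidef) (s : ℕ)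
    (α : ℕ → Matrix (Fin q) (Fin d) ℝ) : 0 ≤ mvCost A C S Q R s α := by
  simp only [mvCost, trace_add, trace_sum]
  have hR' := hR.posSemidef
  exact add_nonneg (add_nonneg (trace_quad_nonneg hS _) (trace_quad_nonneg hR' _))
    (Finset.sum_nonneg fun i _ => add_nonneg (trace_quad_nonneg hQ _) (trace_quad_nonneg hR' _))

lemma dualZ_congr {d q : ℕ} (A : Matrix (Fin d) (Fin d) ℝ) (C : Matrix (Fin q) (Fin d) ℝ)
    {α β : ℕ → Matrix (Fin q) (Fin d) ℝ} {s : ℕ} (h : ∀ i ≤ s, α i = β i) :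
    dualZ A C α s = dualZ A C β s := by
  induction s with
  | zero => simp only [dualZ, h 0 le_rfl]
  | succ s ih => simp only [dualZ, h _ le_rfl, ih fun i hi => h i (hi.trans s.le_succ)]

lemma mvCost_congr {d q : ℕ} (A : Matrix (Fin d) (Fin d) ℝ) (C : Matrix (Fin q) (Fin d) ℝ)
    (S Q : Matrix (Fin d) (Fin d) ℝ) (R : Matrix (Fin q) (Fin q) ℝ)
    {α β : ℕ → Matrix (Fin q) (Fin d) ℝ} {s : ℕ} (h : ∀ i ≤ s, α i = β i) :
    mvCost A C S Q R s α = mvCost A C S Q R s β := by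
  have hz : ∀ i ≤ s, dualZ A C α i = dualZ A C β i :=
    fun i hi => dualZ_congr A C fun j hj => h j (hj.trans hi)
  unfold mvCost
  rw [hz s le_rfl, h s le_rfl]
  congr 2
  refine Finset.sum_congr rfl fun i hi => ?_
  have hi' := (Finset.mem_range.mp hi).le
  rw [hz i hi', h i hi']

lemma mvCost_succ {d q : ℕ} (A : Matrix (Fin d) (Fin d) ℝ) (C : Matrix (Fin q) (Fin d) ℝ)
    {S Q : Matrix (Fin d) (Fin d) ℝ} {R : Matrix (Fin q) (Fin q) ℝ}
    (hR : R.PosDef) (hS : S.PosSemidef) (s : ℕ) (α : ℕ → Matrix (Fin q) (Fin d) ℝ) :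
    mvCost A C S Q R (s + 1) α = mvCost A C (A * posterior C S R * Aᵀ + Q) Q R s α +
      ((α (s + 1) + (C * S * Cᵀ + R)⁻¹ * C * S * (Aᵀ * dualZ A C α s))ᵀ * (C * S * Cᵀ + R) *
        (α (s + 1) + (C * S * Cᵀ + R)⁻¹ * C * S * (Aᵀ * dualZ A C α s))).trace := by
  unfold mvCost
  rw [dualZ, complete_square C hR hS, Finset.sum_range_succ, ← trace_add]
  congr 1
  simp only [transpose_mul, transpose_transpose, Matrix.mul_add, Matrix.add_mul, Matrix.mul_assoc]
  abel

lemma iInf_mvCost_succ {d q : ℕ} (A : Matrix (Fin d) (Fin d) ℝ) (C : Matrix (Fin q) (Fin d) ℝ)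
    {S Q : Matrix (Fin d) (Fin d) ℝ} {R : Matrix (Fin q) (Fin q) ℝ}
    (hR : R.PosDef) (hS : S.PosSemidef) (hQ : Q.PosSemidef) (s : ℕ) :
    (⨅ α : ℕ → Matrix (Fin q) (Fin d) ℝ, mvCost A C S Q R (s + 1) α) =
      ⨅ α : ℕ → Matrix (Fin q) (Fin d) ℝ,
        mvCost A C (A * posterior C S R * Aᵀ + Q) Q R s α := by
  have bdd : ∀ {P : Matrix (Fin d) (Fin d) ℝ}, P.PosSemidef → ∀ n,
      BddBelow (Set.range (mvCost A C P Q R n)) := fun hP n =>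
    ⟨0, Set.forall_mem_range.2 (mvCost_nonneg A C hR hP hQ n)⟩
  apply le_antisymm
  · refine le_ciInf fun α => ?_
    let β := Function.update α (s + 1) (-((C * S * Cᵀ + R)⁻¹ * C * S * (Aᵀ * dualZ A C α s)))
    have hβ : ∀ i ≤ s, β i = α i := fun i hi =>
      Function.update_of_ne (Nat.lt_succ_of_le hi).ne _ _
    have hβs : β (s + 1) = -((C * S * Cᵀ + R)⁻¹ * C * S * (Aᵀ * dualZ A C α s)) :=
      Function.update_self _ _ _
    refine (ciInf_le (bdd hS (s + 1)) β).trans_eq ?_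
    rw [mvCost_succ A C hR hS, hβs, dualZ_congr A C hβ, mvCost_congr A C _ Q R hβ, neg_add_cancel,
      Matrix.mul_zero, trace_zero, add_zero]
  · refine ciInf_mono (bdd (posSemidef_prior_succ A C hR hS hQ) s) fun α => ?_
    rw [mvCost_succ A C hR hS]
    exact le_add_of_nonneg_right
      (trace_quad_nonneg (posDef_innovation C hR hS).posSemidef _)

/-- Lemma 2, equivalence of FIE and MHE costs: if `R ≻ 0` and `Σ_0⁻, Q ⪰ 0`,
then for every `t ≥ N ≥ 0` the infimum over all control sequences of the full-information cost
over horizon `t` (with terminal matrix `Σ_0⁻`) equals the infimum over all control sequences of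
the moving-horizon cost over horizon `N` (with terminal matrix `Σ_{t−N}⁻`). -/
theorem fie_eq_mhe (d q : ℕ)
    (A : Matrix (Fin d) (Fin d) ℝ) (C : Matrix (Fin q) (Fin d) ℝ)
    (S0m Q : Matrix (Fin d) (Fin d) ℝ) (R : Matrix (Fin q) (Fin q) ℝ)
    (hR : R.PosDef) (hS0m : S0m.PosSemidef) (hQ : Q.PosSemidef)
    (t N : ℕ) (hNt : N ≤ t) :
    (⨅ α : ℕ → Matrix (Fin q) (Fin d) ℝ, mvCost A C S0m Q R t α) =
      (⨅ α : ℕ → Matrix (Fin q) (Fin d) ℝ,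
        mvCost A C (sigMinus A C S0m Q R (t - N)) Q R N α) := by
  obtain ⟨k, rfl⟩ := Nat.exists_eq_add_of_le hNt
  rw [Nat.add_sub_cancel_left]
  have shift : ∀ j n, (⨅ α, mvCost A C (sigMinus A C S0m Q R j) Q R (n + 1) α) =
      ⨅ α, mvCost A C (sigMinus A C S0m Q R (j + 1)) Q R n α := fun j n =>
    iInf_mvCost_succ A C hR (posSemidef_sigMinus A C hR hS0m hQ j) hQ n
  clear hNt
  induction k generalizing N with
  | zero => rfl
  | succ k ih => rw [← shift k N, ← ih (N + 1), Nat.add_right_comm, Nat.add_assoc]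
end

section
/- (Nested trace bound in Proposition 2.) Let A be a real d×d matrix, and let P and Q be symmetric positive-semidefinite d×d real matrices. Let Σ_0, …, Σ_k be symmetric positive-semidefinite d×d real matrices and ζ_0, …, ζ_k real d×d matrices such that Σ_0 − ζ_0ᵀ P ζ_0 is positive semidefinite and, for each j = 1, …, k, Σ_j − ζ_jᵀ (A Σ_{j−1} Aᵀ + Q) ζ_j is positive semidefinite. Define γ_0 = ζ_0 and γ_j = γ_{j−1} Aᵀ ζ_j for j = 1, …, k. Then trace(Σ_k) ≥ trace(γ_kᵀ P γ_k). -/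
open Matrix

theorem Matrix.PosSemidef.transpose_mul_mul_same {m n : Type*} [Fintype m] [Fintype n]
    {M : Matrix n n ℝ} (hM : M.PosSemidef) (B : Matrix n m ℝ) : (Bᵀ * M * B).PosSemidef := by
  simpa only [conjTranspose_eq_transpose_of_trivial] using hM.conjTranspose_mul_mul_same B

/-- One step of the nested recursion preserves the Loewner bound. -/
theorem posSemidef_sub_nested_step {n : Type*} [Fintype n]
    {A P Q S T Z G : Matrix n n ℝ} (hQ : Q.PosSemidef)
    (hS : (S - Gᵀ * P * G).PosSemidef)
    (hT : (T - Zᵀ * (A * S * Aᵀ + Q) * Z).PosSemidef) :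
    (T - (G * Aᵀ * Z)ᵀ * P * (G * Aᵀ * Z)).PosSemidef := by
  have key := (hT.add (hQ.transpose_mul_mul_same Z)).add (hS.transpose_mul_mul_same (Aᵀ * Z))
  convert key using 1
  simp only [transpose_mul, transpose_transpose]
  noncomm_ring

/-- Nested trace bound in Proposition 2: let `P, Q ⪰ 0`, let `S 0, …, S k ⪰ 0`
and `ζ 0, …, ζ k` be such that `S 0 − ζ₀ᵀ P ζ₀ ⪰ 0` and
`S j − ζ_jᵀ (A S (j−1) Aᵀ + Q) ζ_j ⪰ 0` for `j = 1, …, k`. With `γ 0 = ζ 0` and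
`γ j = γ (j−1) Aᵀ ζ j`, we get `trace(S k) ≥ trace(γ_kᵀ P γ_k)`. -/
theorem nested_trace_bound (d : ℕ)
    (A P Q : Matrix (Fin d) (Fin d) ℝ)
    (hP : P.PosSemidef) (hQ : Q.PosSemidef)
    (k : ℕ) (S ζ γ : ℕ → Matrix (Fin d) (Fin d) ℝ)
    (hSpsd : ∀ j ≤ k, (S j).PosSemidef)
    (h0 : (S 0 - (ζ 0)ᵀ * P * ζ 0).PosSemidef)
    (hstep : ∀ j, 1 ≤ j → j ≤ k →
      (S j - (ζ j)ᵀ * (A * S (j - 1) * Aᵀ + Q) * ζ j).PosSemidef)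
    (hγ0 : γ 0 = ζ 0)
    (hγ : ∀ j, 1 ≤ j → j ≤ k → γ j = γ (j - 1) * Aᵀ * ζ j) :
    ((γ k)ᵀ * P * γ k).trace ≤ (S k).trace := by
  have loewner : ∀ j ≤ k, (S j - (γ j)ᵀ * P * γ j).PosSemidef := by
    intro j
    induction j with
    | zero => intro _; rwa [hγ0]
    | succ j ih =>
      intro hj
      rw [hγ (j + 1) (Nat.le_add_left 1 j) hj]
      exact posSemidef_sub_nested_step hQ (ih (Nat.le_of_succ_le hj))
        (hstep (j + 1) (Nat.le_add_left 1 j) hj)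
  have h := (loewner k le_rfl).trace_nonneg
  rwa [trace_sub, sub_nonneg] at h
end
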